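/- Let f : [0,∞) → [0,∞)^d assign to each w ≥ 0 the unique point q^w with θ·q^w = w and all µ_i C_i′(q^w_i) equal, and let θ_min = min_i θ_i. Then for every ε > 0, setting δ = εθ_min/2, one has: |w − w′| < δ implies Σ_{i=1}^d |f_i(w) − f_i(w′)| < ε. In particular f is (uniformly) continuous. -/

import Mathlib

/-- A cost function `C` with derivative `C'`, as in the generalized cμ rule setting:
`C : [0,∞) → [0,∞)` is strictly increasing, strictly convex, continuously
differentiable, with `C(0) = C'(0) = 0`. -/
structure CostFun where
  C : ℝ → ℝ
  C' : ℝ → ℝ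
  nonneg : ∀ x ≥ (0:ℝ), 0 ≤ C x
  strictMono : StrictMonoOn C (Set.Ici (0:ℝ))
  strictConvex : StrictConvexOn ℝ (Set.Ici (0:ℝ)) C
  hasDeriv : ∀ x ≥ (0:ℝ), HasDerivWithinAt C (C' x) (Set.Ici (0:ℝ)) x
  contDeriv : ContinuousOn C' (Set.Ici (0:ℝ))
  zero : C 0 = 0
  deriv_zero : C' 0 = 0

theorem CostFun.strictMonoOn_deriv (c : CostFun) : StrictMonoOn c.C' (Set.Ici 0) :=
  fun x hx y hy hxy =>
    (c.strictConvex.lt_slope_of_hasDerivWithinAt hx hy hxy (c.hasDeriv x hx)).trans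
      (c.strictConvex.slope_lt_of_hasDerivWithinAt hx hy hxy (c.hasDeriv y hy))

/-- If the weighted marginal costs `μ_i C_i'` are equalized at both `p` and `q`, and the workload
of `p` is at most that of `q`, then `p ≤ q` coordinatewise. -/
theorem le_of_workload_le {ι : Type*} [Fintype ι] (cf : ι → CostFun) {μ : ι → ℝ}
    (hμ : ∀ i, 0 < μ i) {p q : ι → ℝ} (hp : ∀ i, 0 ≤ p i) (hq : ∀ i, 0 ≤ q i)
    (hpe : ∀ i j, μ i * (cf i).C' (p i) = μ j * (cf j).C' (p j))
    (hqe : ∀ i j, μ i * (cf i).C' (q i) = μ j * (cf j).C' (q j))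
    (hw : ∑ i, (μ i)⁻¹ * p i ≤ ∑ i, (μ i)⁻¹ * q i) (i : ι) : p i ≤ q i := by
  by_contra! hi
  have hlt (j : ι) : q j < p j := by
    have h := mul_lt_mul_of_pos_left
      ((cf i).strictMonoOn_deriv (hq i) (hp i) hi) (hμ i)
    rw [hqe i j, hpe i j] at h
    exact ((cf j).strictMonoOn_deriv.lt_iff_lt (hq j) (hp j)).1
      (lt_of_mul_lt_mul_left h (hμ j).le)
  refine hw.not_gt (Finset.sum_lt_sum_of_nonempty ⟨i, Finset.mem_univ i⟩ fun j _ => ?_)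
  exact mul_lt_mul_of_pos_left (hlt j) (inv_pos.2 (hμ j))

/-- For comparable vectors, the `ℓ¹` distance is controlled by the difference of weighted sums
through any lower bound of the weights. -/
theorem mul_sum_abs_sub_le_of_le {ι : Type*} [Fintype ι] {θ p q : ι → ℝ} {m : ℝ}
    (hm : ∀ i, m ≤ θ i) (hpq : ∀ i, p i ≤ q i) :
    m * ∑ i, |p i - q i| ≤ |∑ i, θ i * p i - ∑ i, θ i * q i| := by
  rw [abs_sub_comm, ← Finset.sum_sub_distrib, Finset.mul_sum]
  refine (Finset.sum_le_sum fun i _ => ?_).trans (le_abs_self _)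
  rw [abs_sub_comm, abs_of_nonneg (sub_nonneg.2 (hpq i)), ← mul_sub]
  exact mul_le_mul_of_nonneg_right (hm i) (sub_nonneg.2 (hpq i))

/-- Let `f : [0,∞) → [0,∞)^d` assign to each `w ≥ 0` the unique point `q^w`
with `θ·q^w = w` (with `θ_i = μ_i⁻¹`) and all `μ_i C_i'(q^w_i)` equal, and let
`θ_min = min_i θ_i`.  For every `ε > 0`, with `δ = ε θ_min / 2`, one has
`|w − w'| < δ ⟹ Σ_i |f_i(w) − f_i(w')| < ε`.  In particular `f` is uniformly
continuous on `[0,∞)`. -/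
theorem f_uniformly_continuous
    (d : ℕ) (hd : 0 < d) (u₁ : ℝ) (hu₁ : 0 < u₁)
    (cf : Fin d → CostFun)
    (hgrowth : ∀ i, ∀ x ≥ (0:ℝ), (cf i).C x ≤ u₁ * x)
    (μ : Fin d → ℝ) (hμ : ∀ i, 0 < μ i)
    (f : ℝ → Fin d → ℝ)
    (hf : ∀ w ≥ (0:ℝ),
      (∀ i, 0 ≤ f w i) ∧ (∑ i, (μ i)⁻¹ * f w i = w) ∧
      (∀ i j, μ i * (cf i).C' (f w i) = μ j * (cf j).C' (f w j)))
    (θmin : ℝ) (hθmin : IsLeast (Set.range fun i => (μ i)⁻¹) θmin) :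
    (∀ ε > (0:ℝ), ∀ w w', 0 ≤ w → 0 ≤ w' → |w - w'| < ε * θmin / 2 →
      ∑ i, |f w i - f w' i| < ε) ∧
    UniformContinuousOn f (Set.Ici 0) := by
  obtain ⟨⟨i₀, hi₀⟩, hle⟩ := hθmin
  have hpos : 0 < θmin := hi₀ ▸ inv_pos.2 (hμ i₀)
  have hmin (i : Fin d) : θmin ≤ (μ i)⁻¹ := hle ⟨i, rfl⟩
  have key : ∀ w w', 0 ≤ w → w ≤ w' → θmin * ∑ i, |f w i - f w' i| ≤ |w - w'| := by
    intro w w' hw hww'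
    obtain ⟨h0, hs, he⟩ := hf w hw
    obtain ⟨h0', hs', he'⟩ := hf w' (hw.trans hww')
    have h := mul_sum_abs_sub_le_of_le hmin
      (le_of_workload_le cf hμ h0 h0' he he' (by rwa [hs, hs']))
    rwa [hs, hs'] at h
  have main : ∀ ε > (0:ℝ), ∀ w w', 0 ≤ w → 0 ≤ w' → |w - w'| < ε * θmin / 2 →
      ∑ i, |f w i - f w' i| < ε := by
    intro ε hε w w' hw hw' hd
    have h : θmin * ∑ i, |f w i - f w' i| ≤ |w - w'| := by
      rcases le_total w w' with h | h
      · exact key w w' hw h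
      · simpa only [abs_sub_comm] using key w' w hw' h
    refine lt_of_mul_lt_mul_left (a := θmin) ?_ hpos.le
    linarith [mul_pos hε hpos]
  refine ⟨main, Metric.uniformContinuousOn_iff.2 fun ε hε =>
    ⟨ε * θmin / 2, by positivity, fun w hw w' hw' hd => ?_⟩⟩
  have hsum := main ε hε w w' hw hw' hd
  refine (dist_pi_lt_iff hε).2 fun i => lt_of_le_of_lt ?_ hsum
  exact Finset.single_le_sum (f := fun i => |f w i - f w' i|)
    (fun j _ => abs_nonneg _) (Finset.mem_univ i)
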